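/- Let f : ℝ → ℝ be a Schwartz function with 0 ≤ f(t) ≤ 1 for all t, whose Fourier transform 𝓕f(ξ) = ∫_ℝ f(t) e^{−2πitξ} dt vanishes outside a compact set. Then there exists K > 0 such that for every real k ≥ K, setting g(t) := f(t)(1 − f(t)) cos(k t) and F := f + g, the following hold: (i) 0 ≤ F(t) ≤ 1 for all t; (ii) ∫_ℝ F = ∫_ℝ f; (iii) ∫_ℝ g² = (1/2) ∫_ℝ (f(1 − f))²; (iv) ∫_ℝ F(1 − F) = ∫_ℝ f(1 − f) − ∫_ℝ g². -/

import Mathlib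

open MeasureTheory Real
open scoped FourierTransform SchwartzMap

/-- The real function `h` is the restriction to real values of a Schwartz function whose Fourier
transform vanishes outside `[-A, A]`. -/
def IsBandlimited (h : ℝ → ℝ) (A : ℝ) : Prop :=
  ∃ H : 𝓢(ℝ, ℂ), (∀ t, H t = h t) ∧ ∀ ξ, A < |ξ| → 𝓕 H ξ = 0

namespace IsBandlimited

variable {h h₁ h₂ : ℝ → ℝ} {A B : ℝ}

theorem mono (hh : IsBandlimited h A) (hAB : A ≤ B) : IsBandlimited h B := by
  obtain ⟨H, hH, hA⟩ := hh
  exact ⟨H, hH, fun ξ hξ => hA ξ (hAB.trans_lt hξ)⟩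

theorem sub (hh₁ : IsBandlimited h₁ A) (hh₂ : IsBandlimited h₂ A) :
    IsBandlimited (fun t => h₁ t - h₂ t) A := by
  obtain ⟨H₁, e₁, z₁⟩ := hh₁
  obtain ⟨H₂, e₂, z₂⟩ := hh₂
  refine ⟨H₁ - H₂, fun t => by simp [e₁, e₂], fun ξ hξ => ?_⟩
  have : 𝓕 (H₁ - H₂) = 𝓕 H₁ - 𝓕 H₂ := map_sub (FourierTransform.fourierCLM ℂ 𝓢(ℝ, ℂ)) H₁ H₂
  rw [this, sub_apply, z₁ ξ hξ, z₂ ξ hξ, sub_zero]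

theorem fourierInv_apply_eq_zero {H : 𝓢(ℝ, ℂ)} (hH : ∀ ξ, A < |ξ| → 𝓕 H ξ = 0) {ξ : ℝ}
    (hξ : A < |ξ|) : 𝓕⁻ H ξ = 0 := by
  rw [SchwartzMap.fourierInv_apply_eq]
  exact hH (-ξ) (by rwa [abs_neg])

theorem mul (hh₁ : IsBandlimited h₁ A) (hh₂ : IsBandlimited h₂ B) :
    IsBandlimited (fun t => h₁ t * h₂ t) (A + B) := by
  obtain ⟨H₁, e₁, z₁⟩ := hh₁
  obtain ⟨H₂, e₂, z₂⟩ := hh₂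
  set M := ContinuousLinearMap.mul ℂ ℂ
  set C := SchwartzMap.convolution M (𝓕⁻ H₁) (𝓕⁻ H₂)
  have hC : 𝓕 C = SchwartzMap.pairing M H₁ H₂ := by
    simp [C, SchwartzMap.fourier_convolution]
  refine ⟨𝓕 C, fun t => by simp [hC, M, e₁, e₂], fun ξ hξ => ?_⟩
  have hneg : 𝓕 (𝓕 C) ξ = C (-ξ) := by
    have h : 𝓕⁻ (𝓕 C) (-ξ) = C (-ξ) := by rw [FourierTransform.fourierInv_fourier_eq]
    rw [SchwartzMap.fourierInv_apply_eq] at h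
    simpa using h
  rw [hneg, SchwartzMap.convolution_apply]
  by_contra hne
  obtain ⟨x, hx, y, hy, hxy⟩ := Set.mem_add.1 (support_convolution_subset M hne)
  have hx' : |x| ≤ A := not_lt.1 fun hlt => hx (fourierInv_apply_eq_zero z₁ hlt)
  have hy' : |y| ≤ B := not_lt.1 fun hlt => hy (fourierInv_apply_eq_zero z₂ hlt)
  have := abs_add_le x y
  rw [hxy, abs_neg] at this
  linarith

theorem integrable (hh : IsBandlimited h A) : Integrable h := by
  obtain ⟨H, e, -⟩ := hh
  simpa [e] using H.integrable (μ := volume).re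

theorem integrable_mul_cos (hh : IsBandlimited h A) (k : ℝ) :
    Integrable fun t => h t * Real.cos (k * t) :=
  hh.integrable.mul_bdd (c := 1) (by fun_prop)
    (Filter.Eventually.of_forall fun t => Real.abs_cos_le_one _)

theorem integral_mul_cos_eq_zero (hh : IsBandlimited h A) {k : ℝ} (hk : 2 * π * A < k) :
    ∫ t, h t * Real.cos (k * t) = 0 := by
  obtain ⟨H, e, z⟩ := hh
  have hz : 𝓕 H (k / (2 * π)) = 0 := by
    refine z _ (lt_of_lt_of_le ?_ (le_abs_self _))
    rw [lt_div_iff₀ (by positivity)]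
    linarith
  rw [SchwartzMap.fourier_coe, Real.fourier_real_eq_integral_exp_smul] at hz
  have hint : Integrable fun t : ℝ =>
      Complex.exp (↑(-2 * π * t * (k / (2 * π))) * Complex.I) • H t :=
    H.integrable.bdd_mul (c := 1) (by fun_prop)
      (Filter.Eventually.of_forall fun t => (Complex.norm_exp_ofReal_mul_I _).le)
  have hre := integral_re hint
  simp only [RCLike.re_to_complex] at hre
  rw [hz, Complex.zero_re] at hre
  rw [← hre]
  refine integral_congr_ae (Filter.Eventually.of_forall fun t => ?_)
  have ht : -2 * π * t * (k / (2 * π)) = -(k * t) := by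
    field_simp
  simp only [ht, e, smul_eq_mul, Complex.re_mul_ofReal, Complex.exp_ofReal_mul_I_re, Real.cos_neg]
  ring

end IsBandlimited

theorem SchwartzMap.exists_isBandlimited (f : 𝓢(ℝ, ℝ))
    (hband : ∃ C : Set ℝ, IsCompact C ∧ ∀ ξ ∉ C, 𝓕 (fun t => (f t : ℂ)) ξ = 0) :
    ∃ A, 0 < A ∧ IsBandlimited f A := by
  obtain ⟨C, hC, hz⟩ := hband
  obtain ⟨A, hA, hCA⟩ := hC.isBounded.exists_pos_norm_le
  refine ⟨A, hA, f.postcompCLM Complex.ofRealCLM, fun t => by simp, fun ξ hξ => ?_⟩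
  exact hz ξ fun hmem => (hCA ξ hmem).not_gt hξ

/-- One induction step of the construction: if `f` is a Schwartz function with values in `[0,1]`
whose Fourier transform vanishes outside a compact set, then there is a threshold `K > 0` such
that for every `k ≥ K`, with `g(t) = f(t)(1 − f(t)) cos(k t)` and `F = f + g`:
(i) `0 ≤ F ≤ 1`; (ii) `∫ F = ∫ f`; (iii) `∫ g² = (1/2) ∫ (f(1−f))²`;
(iv) `∫ F(1−F) = ∫ f(1−f) − ∫ g²`. -/
theorem induction_step (f : 𝓢(ℝ, ℝ)) (hf : ∀ t, 0 ≤ f t ∧ f t ≤ 1)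
    (hband : ∃ C : Set ℝ, IsCompact C ∧ ∀ ξ ∉ C, 𝓕 (fun t => (f t : ℂ)) ξ = 0) :
    ∃ K : ℝ, 0 < K ∧ ∀ k : ℝ, K ≤ k →
      ∀ g F : ℝ → ℝ,
        (∀ t, g t = f t * (1 - f t) * Real.cos (k * t)) →
        (∀ t, F t = f t + g t) →
        (∀ t, 0 ≤ F t ∧ F t ≤ 1) ∧
        (∫ t : ℝ, F t) = (∫ t : ℝ, f t) ∧
        (∫ t : ℝ, g t ^ 2) = (1 / 2) * ∫ t : ℝ, (f t * (1 - f t)) ^ 2 ∧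
        (∫ t : ℝ, F t * (1 - F t)) = (∫ t : ℝ, f t * (1 - f t)) - ∫ t : ℝ, g t ^ 2 := by
  obtain ⟨A, hA, hb⟩ := f.exists_isBandlimited hband
  have hφ : IsBandlimited (fun t => f t * (1 - f t)) (2 * A) := by
    convert! (hb.mono (by linarith : A ≤ 2 * A)).sub ((hb.mul hb).mono (two_mul A).ge) using 2
    ring
  have hφ2 : IsBandlimited (fun t => (f t * (1 - f t)) ^ 2) (4 * A) := by
    convert! (hφ.mul hφ).mono (by linarith : 2 * A + 2 * A ≤ 4 * A) using 2
    ring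
  have hφf : IsBandlimited (fun t => f t * (1 - f t) * (1 - 2 * f t)) (3 * A) := by
    have hm := (hφ.mul hb).mono (by linarith : 2 * A + A ≤ 3 * A)
    convert! ((hφ.mono (by linarith : 2 * A ≤ 3 * A)).sub hm).sub hm using 2
    ring
  refine ⟨2 * π * (4 * A), by positivity, fun k hk g F hg hF => ?_⟩
  have hπA : 0 < π * A := by positivity
  obtain rfl : g = fun t => f t * (1 - f t) * Real.cos (k * t) := funext hg
  obtain rfl : F = fun t => f t + f t * (1 - f t) * Real.cos (k * t) := funext hF
  have hsq : ∀ t, (f t * (1 - f t) * Real.cos (k * t)) ^ 2 =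
      1 / 2 * (f t * (1 - f t)) ^ 2 + 1 / 2 * ((f t * (1 - f t)) ^ 2 * Real.cos (2 * k * t)) := by
    intro t
    rw [mul_pow, Real.cos_sq, mul_assoc 2 k t]
    ring
  have hi1 := hφ2.integrable.const_mul (1 / 2)
  have hi2 := (hφ2.integrable_mul_cos (2 * k)).const_mul (1 / 2)
  have hig2 : Integrable fun t => (f t * (1 - f t) * Real.cos (k * t)) ^ 2 := by
    simp_rw [hsq]
    exact hi1.add hi2
  refine ⟨fun t => ?_, ?_, ?_, ?_⟩
  · obtain ⟨h0, h1⟩ := hf t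
    have hc1 := Real.neg_one_le_cos (k * t)
    have hc2 := Real.cos_le_one (k * t)
    have hp : 0 ≤ f t * (1 - f t) := mul_nonneg h0 (by linarith)
    constructor <;> nlinarith
  · rw [integral_add hb.integrable (hφ.integrable_mul_cos k),
      hφ.integral_mul_cos_eq_zero (by linarith), add_zero]
  · simp_rw [hsq]
    rw [integral_add hi1 hi2, integral_const_mul, integral_const_mul,
      hφ2.integral_mul_cos_eq_zero (by linarith)]
    simp
  · have hexp : ∀ t, (f t + f t * (1 - f t) * Real.cos (k * t)) *
        (1 - (f t + f t * (1 - f t) * Real.cos (k * t))) =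
        f t * (1 - f t) + f t * (1 - f t) * (1 - 2 * f t) * Real.cos (k * t)
          - (f t * (1 - f t) * Real.cos (k * t)) ^ 2 := fun t => by ring
    simp_rw [hexp]
    rw [integral_sub (hφ.integrable.fun_add (hφf.integrable_mul_cos k)) hig2,
      integral_add hφ.integrable (hφf.integrable_mul_cos k),
      hφf.integral_mul_cos_eq_zero (by linarith), add_zero]
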